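/- Let C, C₁, C₂, … be Archimedean copulas with (normalized, right-continuous at 0) generators φ, φ₁, φ₂, …. Then (φ_n) converges pointwise to φ on (0,1] if, and only if, lim_{n→∞} D₁(C_n, C) = 0. -/

import Mathlib

open MeasureTheory Filter Set
open scoped ENNReal

noncomputable section

/-- Right-hand derivative (of a convex function on `[0,1]`) of `f` at `x`, realized as the
infimum of the forward difference quotients with right endpoint in `(x, 1]`. -/
noncomputable def rightD (f : ℝ → ℝ) (x : ℝ) : ℝ :=
  sInf ((fun y => (f y - f x) / (y - x)) '' Set.Ioc x 1)

/-- `φ : [0,1] → [0,∞]` is a (normalized, right-continuous at `0`) generator of an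
Archimedean copula: convex, strictly decreasing, `φ 1 = 0`, finite on `(0,1]`,
right-continuous at `0` and normalized by `φ (1/2) = 1`. -/
structure IsGenerator (φ : ℝ → ℝ≥0∞) : Prop where
  convex : ∀ x ∈ Set.Icc (0:ℝ) 1, ∀ y ∈ Set.Icc (0:ℝ) 1, ∀ t ∈ Set.Icc (0:ℝ) 1,
    φ (t * x + (1 - t) * y) ≤ ENNReal.ofReal t * φ x + ENNReal.ofReal (1 - t) * φ y
  strict_anti : ∀ x ∈ Set.Icc (0:ℝ) 1, ∀ y ∈ Set.Icc (0:ℝ) 1, x < y → φ y < φ x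
  map_one : φ 1 = 0
  finite : ∀ x ∈ Set.Ioc (0:ℝ) 1, φ x < ⊤
  rightCont_zero : Filter.Tendsto φ (nhdsWithin 0 (Set.Ioi 0)) (nhds (φ 0))
  normalized : φ (1/2) = 1

/-- Pseudo-inverse `φ⁻` of a generator: `φ⁻ s = φ⁻¹ s` for `s < φ 0` and `0` for `s ≥ φ 0`. -/
noncomputable def pseudoInv (φ : ℝ → ℝ≥0∞) (s : ℝ≥0∞) : ℝ :=
  sSup {x | x ∈ Set.Icc (0:ℝ) 1 ∧ s ≤ φ x}

/-- The Archimedean copula generated by `φ`: `C(x,y) = φ⁻(φ x + φ y)`. -/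
noncomputable def archCopula (φ : ℝ → ℝ≥0∞) (x y : ℝ) : ℝ :=
  pseudoInv φ (φ x + φ y)

/-- The right-hand derivative `D⁺φ` of a generator. -/
noncomputable def Dplus (φ : ℝ → ℝ≥0∞) (x : ℝ) : ℝ :=
  rightD (fun t => (φ t).toReal) x

/-- The set `Cont(D⁺φ)` of continuity points of `D⁺φ` in `(0,1)`. -/
def ContD (φ : ℝ → ℝ≥0∞) : Set ℝ :=
  {x | x ∈ Set.Ioo (0:ℝ) 1 ∧ ContinuousAt (Dplus φ) x}

/-- The `t`-level function `f^t(x) = φ⁻(φ t − φ x)` of the Archimedean copula generated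
by `φ`. -/
noncomputable def levelFn (φ : ℝ → ℝ≥0∞) (t x : ℝ) : ℝ :=
  pseudoInv φ (φ t - φ x)

/-- The Kendall distribution function `F^Kendall(x) = x − φ(x)/D⁺φ(x)` of the Archimedean
copula generated by `φ`. -/
noncomputable def kendall (φ : ℝ → ℝ≥0∞) (x : ℝ) : ℝ :=
  x - (φ x).toReal / Dplus φ x

/-- The Markov kernel (as conditional distribution function `(x,y) ↦ K_C(x,[0,y])`) of the
Archimedean copula generated by `φ`. -/
noncomputable def archKernel (φ : ℝ → ℝ≥0∞) (x y : ℝ) : ℝ :=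
  if x = 0 ∨ x = 1 then 1
  else if y < levelFn φ 0 x then 0
  else Dplus φ x / Dplus φ (archCopula φ x y)

/-- The metric `D₁` between two copulas, expressed via their conditional distribution
functions `K₁, K₂` (with `Kᵢ x y = K_{Cᵢ}(x,[0,y])`). -/
noncomputable def D1 (K1 K2 : ℝ → ℝ → ℝ) : ℝ :=
  ∫ y in Set.Icc (0:ℝ) 1, ∫ x in Set.Icc (0:ℝ) 1, |K1 x y - K2 x y|

/-- Conditional distribution function of the independence copula `Π`. -/
def piKernel : ℝ → ℝ → ℝ := fun _ y => y

/-- Dependence measure `ζ₁(C) = 3 D₁(C, Π)`. -/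
noncomputable def zeta1 (K : ℝ → ℝ → ℝ) : ℝ := 3 * D1 K piKernel

/-- Dependence measure `r(C) = 6 ∫∫ K_C(x,[0,y])² dλ(x) dλ(y) − 2`. -/
noncomputable def rdep (K : ℝ → ℝ → ℝ) : ℝ :=
  6 * (∫ y in Set.Icc (0:ℝ) 1, ∫ x in Set.Icc (0:ℝ) 1, (K x y) ^ 2) - 2

/-- Weak conditional convergence of a sequence of copulas, in terms of their conditional
distribution functions: for λ-a.e. `x ∈ [0,1]` the measures `K_{C_n}(x,·)` converge weakly
to `K_C(x,·)`, i.e. the conditional distribution functions converge at every continuity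
point of `y ↦ K_C(x,[0,y])` in `[0,1]`. -/
def WeakCondConv (Kseq : ℕ → ℝ → ℝ → ℝ) (K : ℝ → ℝ → ℝ) : Prop :=
  ∀ᵐ x ∂(volume.restrict (Set.Icc (0:ℝ) 1)),
    ∀ y ∈ Set.Icc (0:ℝ) 1, ContinuousWithinAt (fun t => K x t) (Set.Icc 0 1) y →
      Filter.Tendsto (fun n => Kseq n x y) Filter.atTop (nhds (K x y))

namespace IsGenerator

variable {φ : ℝ → ℝ≥0∞} {x y a : ℝ}

/-! ### The generator as a real function -/

lemma ne_top (h : IsGenerator φ) (hx : x ∈ Ioc (0:ℝ) 1) : φ x ≠ ⊤ := (h.finite x hx).ne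

lemma strictAntiOn_toReal (h : IsGenerator φ) :
    StrictAntiOn (fun t => (φ t).toReal) (Ioc (0:ℝ) 1) := fun _ hx _ hy hxy =>
  ENNReal.toReal_strict_mono (h.ne_top hx)
    (h.strict_anti _ (Ioc_subset_Icc_self hx) _ (Ioc_subset_Icc_self hy) hxy)

lemma antitoneOn (h : IsGenerator φ) : AntitoneOn φ (Icc (0:ℝ) 1) :=
  StrictAntiOn.antitoneOn fun x hx y hy hxy => h.strict_anti x hx y hy hxy

lemma convexOn_toReal (h : IsGenerator φ) :
    ConvexOn ℝ (Ioc (0:ℝ) 1) (fun t => (φ t).toReal) := by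
  refine ⟨convex_Ioc 0 1, fun x hx y hy s t hs ht hst => ?_⟩
  have ht' : t = 1 - s := by linarith
  subst ht'
  have hc := h.convex x (Ioc_subset_Icc_self hx) y (Ioc_subset_Icc_self hy) s ⟨hs, by linarith⟩
  have hfx := ENNReal.mul_ne_top (ENNReal.ofReal_ne_top (r := s)) (h.ne_top hx)
  have hfy := ENNReal.mul_ne_top (ENNReal.ofReal_ne_top (r := 1 - s)) (h.ne_top hy)
  have := ENNReal.toReal_mono (ENNReal.add_ne_top.2 ⟨hfx, hfy⟩) hc
  rwa [ENNReal.toReal_add hfx hfy, ENNReal.toReal_mul, ENNReal.toReal_mul,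
    ENNReal.toReal_ofReal hs, ENNReal.toReal_ofReal ht] at this

lemma continuousOn_toReal (h : IsGenerator φ) :
    ContinuousOn (fun t => (φ t).toReal) (Ioo (0:ℝ) 1) :=
  (h.convexOn_toReal.subset Ioo_subset_Ioc_self (convex_Ioo 0 1)).continuousOn isOpen_Ioo

lemma toReal_one (h : IsGenerator φ) : (φ 1).toReal = 0 := by simp [h.map_one]

lemma toReal_half (h : IsGenerator φ) : (φ (1/2)).toReal = 1 := by
  rw [h.normalized]; rfl

lemma toReal_pos (h : IsGenerator φ) (hx : x ∈ Ioo (0:ℝ) 1) : 0 < (φ x).toReal := by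
  simpa [h.toReal_one] using
    h.strictAntiOn_toReal (Ioo_subset_Ioc_self hx) ⟨one_pos, le_rfl⟩ hx.2

lemma toReal_le_two_mul (h : IsGenerator φ) (hx : 1/2 ≤ x) (hx1 : x ≤ 1) :
    (φ x).toReal ≤ 2 * (1 - x) := by
  have := h.convexOn_toReal.2 (show (1/2 : ℝ) ∈ Ioc (0:ℝ) 1 by norm_num)
    (show (1 : ℝ) ∈ Ioc (0:ℝ) 1 by norm_num) (show 0 ≤ 2 - 2 * x by linarith)
    (show 0 ≤ 2 * x - 1 by linarith) (by ring)
  simp only [smul_eq_mul, h.toReal_half, h.toReal_one] at this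
  rw [show (2 - 2 * x) * (1/2) + (2 * x - 1) * 1 = x by ring] at this
  linarith

lemma toReal_sub_le (h : IsGenerator φ) {d : ℝ} (ha : 0 < a) (hax : a ≤ x) (hd : 0 < d)
    (hx : x + d ≤ 1) :
    (φ x).toReal - (φ (x + d)).toReal ≤ (φ a).toReal - (φ (a + d)).toReal := by
  have hp : 0 < x + d - a := by linarith
  have hs0 : 0 ≤ d / (x + d - a) := by positivity
  have hs1 : d / (x + d - a) ≤ 1 := by rw [div_le_one hp]; linarith
  have hsd : d / (x + d - a) * (x + d - a) = d := div_mul_cancel₀ _ hp.ne'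
  set s := d / (x + d - a)
  have ha' : a ∈ Ioc (0:ℝ) 1 := ⟨ha, by linarith⟩
  have hx' : x + d ∈ Ioc (0:ℝ) 1 := ⟨by linarith, hx⟩
  have h1 := h.convexOn_toReal.2 ha' hx' hs0 (sub_nonneg.2 hs1) (by ring)
  have h2 := h.convexOn_toReal.2 ha' hx' (sub_nonneg.2 hs1) hs0 (by ring)
  simp only [smul_eq_mul] at h1 h2
  rw [show s * a + (1 - s) * (x + d) = x by linear_combination -hsd] at h1
  rw [show (1 - s) * a + s * (x + d) = a + d by linear_combination hsd] at h2
  linarith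

/-! ### The right-hand derivative -/

lemma slope_le_slope (h : IsGenerator φ) {z : ℝ} (hx : 0 < x) (hxy : x < y) (hyz : y < z)
    (hz : z ≤ 1) :
    ((φ y).toReal - (φ x).toReal) / (y - x) ≤ ((φ z).toReal - (φ y).toReal) / (z - y) :=
  h.convexOn_toReal.slope_mono_adjacent (x := x) (y := y) (z := z)
    ⟨hx, by linarith⟩ ⟨by linarith, hz⟩ hxy hyz

lemma slope_le_Dplus (h : IsGenerator φ) (hx : 0 < x) (hxy : x < y) (hy : y < 1) :
    ((φ y).toReal - (φ x).toReal) / (y - x) ≤ Dplus φ y := by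
  refine le_csInf (Set.Nonempty.image _ ⟨1, hy, le_rfl⟩) ?_
  rintro _ ⟨z, hz, rfl⟩
  exact h.slope_le_slope hx hxy hz.1 hz.2

lemma Dplus_le_slope (h : IsGenerator φ) (hx : 0 < x) (hxy : x < y) (hy : y ≤ 1) :
    Dplus φ x ≤ ((φ y).toReal - (φ x).toReal) / (y - x) := by
  refine csInf_le ⟨((φ x).toReal - (φ (x/2)).toReal) / (x - x/2), ?_⟩ ⟨y, ⟨hxy, hy⟩, rfl⟩
  rintro _ ⟨z, hz, rfl⟩
  exact h.slope_le_slope (by linarith) (by linarith) hz.1 hz.2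

lemma monotoneOn_Dplus (h : IsGenerator φ) : MonotoneOn (Dplus φ) (Ioo 0 1) := by
  intro x hx y hy hxy
  rcases hxy.eq_or_lt with rfl | hxy
  · rfl
  · exact (h.Dplus_le_slope hx.1 hxy hy.2.le).trans (h.slope_le_Dplus hx.1 hxy hy.2)

lemma Dplus_neg (h : IsGenerator φ) (hx : x ∈ Ioo (0:ℝ) 1) : Dplus φ x < 0 := by
  refine (h.Dplus_le_slope hx.1 hx.2 le_rfl).trans_lt ?_
  rw [h.toReal_one]
  exact div_neg_of_neg_of_pos (by linarith [h.toReal_pos hx]) (by linarith [hx.2])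

lemma hasDerivWithinAt_toReal (h : IsGenerator φ) (hx : x ∈ Ioo (0:ℝ) 1) :
    HasDerivWithinAt (fun t => (φ t).toReal) (Dplus φ x) (Ioi x) x := by
  have := h.convexOn_toReal.hasDerivWithinAt_sInf_slope_of_mem_interior (x := x)
    (by rwa [interior_Ioc])
  convert this using 1
  rw [Dplus, rightD]
  congr 1
  ext r
  simp only [mem_image, mem_Ioc, mem_ofPred_eq, slope_def_field]
  constructor
  · rintro ⟨z, hz, rfl⟩
    exact ⟨z, ⟨⟨hx.1.trans hz.1, hz.2⟩, hz.1⟩, rfl⟩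
  · rintro ⟨z, hz, rfl⟩
    exact ⟨z, ⟨hz.2, hz.1.2⟩, rfl⟩

lemma countable_not_continuousAt_Dplus (h : IsGenerator φ) :
    {x | x ∈ Ioo (0:ℝ) 1 ∧ ¬ ContinuousAt (Dplus φ) x}.Countable := by
  refine h.monotoneOn_Dplus.countable_not_continuousWithinAt.mono ?_
  rintro x ⟨hx, hnc⟩
  exact ⟨hx, fun hc => hnc (hc.continuousAt (isOpen_Ioo.mem_nhds hx))⟩

/-! ### The copula -/

lemma bddAbove_setOf_le (φ : ℝ → ℝ≥0∞) (s : ℝ≥0∞) :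
    BddAbove {x | x ∈ Icc (0:ℝ) 1 ∧ s ≤ φ x} := ⟨1, fun _ hx => hx.1.2⟩

end IsGenerator

lemma pseudoInv_nonneg (φ : ℝ → ℝ≥0∞) (s : ℝ≥0∞) : 0 ≤ pseudoInv φ s :=
  Real.sSup_nonneg fun _ hx => hx.1.1

lemma antitone_pseudoInv (φ : ℝ → ℝ≥0∞) : Antitone (pseudoInv φ) := by
  intro s t hst
  exact Real.sSup_le (fun a ha => le_csSup (IsGenerator.bddAbove_setOf_le φ s)
    ⟨ha.1, hst.trans ha.2⟩) (pseudoInv_nonneg φ s)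

lemma archCopula_comm (φ : ℝ → ℝ≥0∞) (x y : ℝ) : archCopula φ x y = archCopula φ y x := by
  rw [archCopula, archCopula, add_comm]

lemma archCopula_nonneg (φ : ℝ → ℝ≥0∞) (x y : ℝ) : 0 ≤ archCopula φ x y :=
  pseudoInv_nonneg φ _

namespace IsGenerator

variable {φ : ℝ → ℝ≥0∞} {x y a : ℝ}

lemma archCopula_le_left (h : IsGenerator φ) (hx : x ∈ Icc (0:ℝ) 1) (y : ℝ) :
    archCopula φ x y ≤ x := by
  refine Real.sSup_le (fun a ha => ?_) hx.1
  by_contra! hxa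
  exact absurd ((h.strict_anti x hx a ha.1 hxa).trans_le (le_self_add.trans ha.2)) (lt_irrefl _)

lemma archCopula_mem_Icc (h : IsGenerator φ) (hx : x ∈ Icc (0:ℝ) 1) (y : ℝ) :
    archCopula φ x y ∈ Icc (0:ℝ) 1 :=
  ⟨archCopula_nonneg φ x y, (h.archCopula_le_left hx y).trans hx.2⟩

lemma archCopula_mem_Ioo (h : IsGenerator φ) (hx : x ∈ Ioo (0:ℝ) 1)
    (hpos : 0 < archCopula φ x y) : archCopula φ x y ∈ Ioo (0:ℝ) 1 :=
  ⟨hpos, (h.archCopula_le_left (Ioo_subset_Icc_self hx) y).trans_lt hx.2⟩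

lemma le_iff_toReal (h : IsGenerator φ) (hx : x ∈ Ioc (0:ℝ) 1) (hy : y ∈ Ioc (0:ℝ) 1)
    (ha : a ∈ Ioc (0:ℝ) 1) :
    φ x + φ y ≤ φ a ↔ (φ x).toReal + (φ y).toReal ≤ (φ a).toReal := by
  rw [← ENNReal.toReal_add (h.ne_top hx) (h.ne_top hy), ENNReal.toReal_le_toReal
    (ENNReal.add_ne_top.2 ⟨h.ne_top hx, h.ne_top hy⟩) (h.ne_top ha)]

lemma le_archCopula (h : IsGenerator φ) (hx : x ∈ Ioc (0:ℝ) 1) (hy : y ∈ Ioc (0:ℝ) 1)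
    (ha : a ∈ Ioc (0:ℝ) 1) (hle : (φ x).toReal + (φ y).toReal ≤ (φ a).toReal) :
    a ≤ archCopula φ x y :=
  le_csSup (bddAbove_setOf_le φ _) ⟨Ioc_subset_Icc_self ha, (h.le_iff_toReal hx hy ha).2 hle⟩

lemma archCopula_le (h : IsGenerator φ) (hx : x ∈ Ioc (0:ℝ) 1) (hy : y ∈ Ioc (0:ℝ) 1)
    (ha : a ∈ Ioc (0:ℝ) 1) (hle : (φ a).toReal < (φ x).toReal + (φ y).toReal) :
    archCopula φ x y ≤ a := by
  refine Real.sSup_le (fun b hb => ?_) ha.1.le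
  by_contra! hab
  have hb' : b ∈ Ioc (0:ℝ) 1 := ⟨ha.1.trans hab, hb.1.2⟩
  have := (h.le_iff_toReal hx hy hb').1 hb.2
  linarith [h.strictAntiOn_toReal ha hb' hab]

lemma toReal_lt_of_archCopula_lt (h : IsGenerator φ) (hx : x ∈ Ioc (0:ℝ) 1)
    (hy : y ∈ Ioc (0:ℝ) 1) (ha : a ≤ 1) (hlt : archCopula φ x y < a) :
    (φ a).toReal < (φ x).toReal + (φ y).toReal := by
  by_contra! hle
  exact absurd (h.le_archCopula hx hy ⟨(archCopula_nonneg φ x y).trans_lt hlt, ha⟩ hle)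
    (not_le.2 hlt)

lemma le_toReal_of_lt_archCopula (h : IsGenerator φ) (hx : x ∈ Ioc (0:ℝ) 1)
    (hy : y ∈ Ioc (0:ℝ) 1) (ha : 0 < a) (hlt : a < archCopula φ x y) :
    (φ x).toReal + (φ y).toReal ≤ (φ a).toReal := by
  by_contra! hle
  have ha1 := hlt.le.trans (h.archCopula_mem_Icc (Ioc_subset_Icc_self hx) y).2
  exact absurd (h.archCopula_le hx hy ⟨ha, ha1⟩ hle) (not_le.2 hlt)

lemma archCopula_one_left (h : IsGenerator φ) (hy : y ∈ Icc (0:ℝ) 1) : archCopula φ 1 y = y := by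
  refine le_antisymm ?_ ?_
  · rw [archCopula_comm]; exact h.archCopula_le_left hy 1
  · exact le_csSup (bddAbove_setOf_le φ _) ⟨hy, by simp [h.map_one]⟩

lemma toReal_archCopula (h : IsGenerator φ) (hx : x ∈ Ioc (0:ℝ) 1) (hy : y ∈ Ioo (0:ℝ) 1)
    (hpos : 0 < archCopula φ x y) :
    (φ (archCopula φ x y)).toReal = (φ x).toReal + (φ y).toReal := by
  have hy' := Ioo_subset_Ioc_self hy
  have hc1 : archCopula φ x y < 1 := by
    rw [archCopula_comm]
    exact (h.archCopula_le_left (Ioo_subset_Icc_self hy) x).trans_lt hy.2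
  have hcont := h.continuousOn_toReal.continuousAt (isOpen_Ioo.mem_nhds ⟨hpos, hc1⟩)
  apply le_antisymm
  · refine le_of_tendsto (hcont.mono_left (nhdsWithin_le_nhds (s := Ioi (archCopula φ x y)))) ?_
    filter_upwards [Ioo_mem_nhdsGT hc1] with a ha
    exact (h.toReal_lt_of_archCopula_lt hx hy' ha.2.le ha.1).le
  · refine ge_of_tendsto (hcont.mono_left (nhdsWithin_le_nhds (s := Iio (archCopula φ x y)))) ?_
    filter_upwards [Ioo_mem_nhdsLT hpos] with a ha
    exact h.le_toReal_of_lt_archCopula hx hy' ha.1 ha.2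

lemma archCopula_pos_iff (h : IsGenerator φ) (hx : x ∈ Ioc (0:ℝ) 1) (hy : y ∈ Ioo (0:ℝ) 1) :
    0 < archCopula φ x y ↔ φ x + φ y < φ 0 := by
  constructor
  · intro hpos
    have hc : archCopula φ x y ∈ Icc (0:ℝ) 1 := h.archCopula_mem_Icc (Ioc_subset_Icc_self hx) y
    refine lt_of_le_of_lt ?_ (h.strict_anti 0 ⟨le_rfl, zero_le_one⟩ _ hc hpos)
    exact (h.le_iff_toReal hx (Ioo_subset_Ioc_self hy) ⟨hpos, hc.2⟩).2
      (h.toReal_archCopula hx hy hpos).ge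
  · intro hlt
    obtain ⟨a, ha, ha'⟩ := ((h.rightCont_zero.eventually (lt_mem_nhds hlt)).and
      (Ioo_mem_nhdsGT one_pos)).exists
    exact ha'.1.trans_le (le_csSup (bddAbove_setOf_le φ _) ⟨Ioo_subset_Icc_self ha', ha.le⟩)

lemma archCopula_mono_left (h : IsGenerator φ) {x' : ℝ} (hx : x ∈ Icc (0:ℝ) 1)
    (hx' : x' ∈ Icc (0:ℝ) 1) (hxx : x ≤ x') (y : ℝ) : archCopula φ x y ≤ archCopula φ x' y :=
  antitone_pseudoInv φ (add_le_add_left (h.antitoneOn hx hx' hxx) _)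

lemma archCopula_lt_left (h : IsGenerator φ) (hx : x ∈ Ioc (0:ℝ) 1) (hy : y ∈ Ioo (0:ℝ) 1) :
    archCopula φ x y < x := by
  rcases (archCopula_nonneg φ x y).eq_or_lt with h0 | hpos
  · rw [← h0]; exact hx.1
  · refine (h.archCopula_le_left (Ioc_subset_Icc_self hx) y).lt_of_ne fun he => ?_
    have := h.toReal_archCopula hx hy hpos
    rw [he] at this
    linarith [h.toReal_pos hy]

lemma archCopula_sub_le (h : IsGenerator φ) {x' : ℝ} (hx : 0 ≤ x) (hxx : x ≤ x') (hx' : x' ≤ 1)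
    (hy : y ∈ Ioo (0:ℝ) 1) : archCopula φ x' y - archCopula φ x y ≤ x' - x := by
  rcases hx.eq_or_lt with rfl | hx0
  · linarith [h.archCopula_le_left ⟨hx.trans hxx, hx'⟩ y, archCopula_nonneg φ 0 y]
  rcases hxx.eq_or_lt with rfl | hlt
  · simp
  have hxm : x ∈ Ioc (0:ℝ) 1 := ⟨hx0, hxx.trans hx'⟩
  have hxm' : x' ∈ Ioc (0:ℝ) 1 := ⟨hx0.trans hlt, hx'⟩
  have hy' := Ioo_subset_Ioc_self hy
  by_contra! hcon
  obtain ⟨a, haz, ha⟩ := exists_between (show archCopula φ x y < min x (archCopula φ x' y - (x' - x))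
    from lt_min (h.archCopula_lt_left hxm hy) (by linarith))
  obtain ⟨hax, haz'⟩ := lt_min_iff.1 ha
  have ha0 := (archCopula_nonneg φ x y).trans_lt haz
  have hz0 : 0 < archCopula φ x' y := by linarith
  have hz1 := (h.archCopula_mem_Icc (Ioc_subset_Icc_self hxm') y).2
  have h1 := h.toReal_lt_of_archCopula_lt hxm hy' (hax.le.trans hxm.2) haz
  have h2 := h.toReal_archCopula hxm' hy hz0
  have h3 := h.toReal_sub_le (d := x' - x) ha0 hax.le (by linarith) (by linarith)
  have h4 := h.strictAntiOn_toReal (a := a + (x' - x)) (b := archCopula φ x' y)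
    ⟨by linarith, by linarith⟩ ⟨hz0, hz1⟩ (by linarith)
  rw [add_sub_cancel] at h3
  linarith

lemma abs_archCopula_sub_le (h : IsGenerator φ) {x' : ℝ} (hx : x ∈ Icc (0:ℝ) 1)
    (hx' : x' ∈ Icc (0:ℝ) 1) (hy : y ∈ Ioo (0:ℝ) 1) :
    |archCopula φ x y - archCopula φ x' y| ≤ |x - x'| := by
  rcases le_total x x' with hle | hle
  · rw [abs_sub_comm, abs_sub_comm x, abs_of_nonneg (sub_nonneg.2 hle),
      abs_of_nonneg (sub_nonneg.2 (h.archCopula_mono_left hx hx' hle y))]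
    exact h.archCopula_sub_le hx.1 hle hx'.2 hy
  · rw [abs_of_nonneg (sub_nonneg.2 hle),
      abs_of_nonneg (sub_nonneg.2 (h.archCopula_mono_left hx' hx hle y))]
    exact h.archCopula_sub_le hx'.1 hle hx.2 hy

lemma continuousOn_archCopula (h : IsGenerator φ) (hy : y ∈ Ioo (0:ℝ) 1) :
    ContinuousOn (fun x => archCopula φ x y) (Icc 0 1) := by
  refine (LipschitzOnWith.of_dist_le_mul (K := 1) fun x hx x' hx' => ?_).continuousOn
  simpa [Real.dist_eq] using h.abs_archCopula_sub_le hx hx' hy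

end IsGenerator

/-! ### The Markov kernel off the zero level curve -/

/-- The Lebesgue measure on the open unit interval. -/
abbrev unitVolume : Measure ℝ := volume.restrict (Ioo (0:ℝ) 1)

/-- The Markov kernel `archKernel`, described through the positivity of the copula instead of its
zero level function. -/
def posKernel (φ : ℝ → ℝ≥0∞) (x y : ℝ) : ℝ :=
  if 0 < archCopula φ x y then Dplus φ x / Dplus φ (archCopula φ x y) else 0

lemma AntitoneOn.measurable_indicator_Ioo {β : Type*} [MeasurableSpace β] [TopologicalSpace β]
    [BorelSpace β] [LinearOrder β] [OrderTopology β] [SecondCountableTopology β] [Zero β]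
    {f : ℝ → β} {a b : ℝ} (hf : AntitoneOn f (Ioo a b)) : Measurable ((Ioo a b).indicator f) := by
  refine measurable_of_restrict_of_restrict_compl (measurableSet_Ioo (a := a) (b := b)) ?_ ?_
  · refine Antitone.measurable ?_
    rintro ⟨s, hs⟩ ⟨t, ht⟩ hst
    simpa only [domRestrict_apply, indicator_of_mem, hs, ht] using hf hs ht hst
  · have : ((Ioo a b)ᶜ.domRestrict ((Ioo a b).indicator f)) = fun _ => 0 := by
      ext ⟨t, ht⟩
      simpa only [domRestrict_apply] using indicator_of_notMem ht f
    rw [this]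
    exact measurable_const

namespace IsGenerator

variable {φ ψ : ℝ → ℝ≥0∞} {x y a : ℝ}

lemma archKernel_eq_posKernel (h : IsGenerator φ) (hx : x ∈ Ioo (0:ℝ) 1) (hy : y ∈ Ioo (0:ℝ) 1)
    (hne : φ x + φ y ≠ φ 0) : archKernel φ x y = posKernel φ x y := by
  have hx' := Ioo_subset_Ioc_self hx
  rw [archKernel, posKernel, if_neg (by rintro (h0 | h1); exacts [hx.1.ne' h0, hx.2.ne h1])]
  rcases hne.lt_or_gt with hlt | hgt
  · rw [if_pos ((h.archCopula_pos_iff hx' hy).2 hlt), if_neg]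
    refine not_lt.2 (Real.sSup_le (fun a ha => ?_) hy.1.le)
    by_contra! hya
    have h1 : φ 0 ≤ φ x + φ a := le_add_tsub.trans (add_le_add_right ha.2 _)
    have h2 := h.strict_anti y (Ioo_subset_Icc_self hy) a ha.1 hya
    exact absurd (h1.trans (add_le_add_right h2.le _)) (not_le.2 hlt)
  · rw [if_neg (show ¬ 0 < archCopula φ x y from fun hp =>
      (((h.archCopula_pos_iff hx' hy).1 hp).trans hgt).false), if_pos]
    have hx0 : φ x ≤ φ 0 :=
      (h.strict_anti 0 ⟨le_rfl, zero_le_one⟩ x (Ioo_subset_Icc_self hx) hx.1).le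
    have h1 : φ 0 - φ x < φ y := by
      rwa [← ENNReal.add_lt_add_iff_left (h.ne_top hx'), add_tsub_cancel_of_le hx0]
    have h2 := (ENNReal.toReal_lt_toReal h1.ne_top (h.ne_top (Ioo_subset_Ioc_self hy))).2 h1
    have hcont := (h.continuousOn_toReal.continuousAt (isOpen_Ioo.mem_nhds hy)).mono_left
      (nhdsWithin_le_nhds (s := Ioi y))
    obtain ⟨b, hb, hb'⟩ := ((hcont.eventually (lt_mem_nhds h2)).and (Ioo_mem_nhdsGT hy.2)).exists
    have hbm : b ∈ Ioo (0:ℝ) 1 := ⟨hy.1.trans hb'.1, hb'.2⟩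
    refine hb'.1.trans_le (le_csSup (bddAbove_setOf_le φ _) ⟨Ioo_subset_Icc_self hbm, ?_⟩)
    exact ((ENNReal.toReal_lt_toReal h1.ne_top (h.ne_top (Ioo_subset_Ioc_self hbm))).1 hb).le

lemma ae_add_ne (h : IsGenerator φ) (hy : y ∈ Ioo (0:ℝ) 1) :
    ∀ᵐ x ∂unitVolume, φ x + φ y ≠ φ 0 := by
  have hs : {x | x ∈ Ioo (0:ℝ) 1 ∧ φ x + φ y = φ 0}.Subsingleton := by
    rintro s ⟨hs, hs'⟩ t ⟨ht, ht'⟩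
    have he : φ s = φ t :=
      (ENNReal.add_left_inj (h.ne_top (Ioo_subset_Ioc_self hy))).1 (hs'.trans ht'.symm)
    exact h.strictAntiOn_toReal.injOn (Ioo_subset_Ioc_self hs) (Ioo_subset_Ioc_self ht)
      (congrArg ENNReal.toReal he)
  filter_upwards [hs.countable.ae_notMem unitVolume, ae_restrict_mem measurableSet_Ioo]
    with x hx hx' he using hx ⟨hx', he⟩

lemma D1_eq (h : IsGenerator φ) (h' : IsGenerator ψ) :
    D1 (archKernel φ) (archKernel ψ) =
      ∫ y, ∫ x, |posKernel φ x y - posKernel ψ x y| ∂unitVolume ∂unitVolume := by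
  simp only [D1, integral_Icc_eq_integral_Ioc, integral_Ioc_eq_integral_Ioo]
  refine integral_congr_ae ?_
  filter_upwards [ae_restrict_mem measurableSet_Ioo] with y hy
  refine integral_congr_ae ?_
  filter_upwards [ae_restrict_mem measurableSet_Ioo, h.ae_add_ne hy, h'.ae_add_ne hy]
    with x hx h1 h2
  rw [h.archKernel_eq_posKernel hx hy h1, h'.archKernel_eq_posKernel hx hy h2]

lemma posKernel_nonneg (h : IsGenerator φ) (hx : x ∈ Ioo (0:ℝ) 1) (y : ℝ) :
    0 ≤ posKernel φ x y := by
  rw [posKernel]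
  split_ifs with hc
  · exact div_nonneg_of_nonpos (h.Dplus_neg hx).le (h.Dplus_neg (h.archCopula_mem_Ioo hx hc)).le
  · rfl

lemma posKernel_le_one (h : IsGenerator φ) (hx : x ∈ Ioo (0:ℝ) 1) (y : ℝ) :
    posKernel φ x y ≤ 1 := by
  rw [posKernel]
  split_ifs with hc
  · have hcm := h.archCopula_mem_Ioo hx hc
    rw [div_le_one_of_neg (h.Dplus_neg hcm)]
    exact h.monotoneOn_Dplus hcm hx (h.archCopula_le_left (Ioo_subset_Icc_self hx) y)
  · exact zero_le_one

lemma abs_posKernel_sub_le_one (h : IsGenerator φ) (h' : IsGenerator ψ) (hx : x ∈ Ioo (0:ℝ) 1)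
    (y : ℝ) : |posKernel φ x y - posKernel ψ x y| ≤ 1 :=
  abs_sub_le_of_le_of_le (h.posKernel_nonneg hx y) (h.posKernel_le_one hx y)
    (h'.posKernel_nonneg hx y) (h'.posKernel_le_one hx y) |>.trans (by norm_num)

lemma exists_measurable_eq_posKernel (h : IsGenerator φ) :
    ∃ M : ℝ → ℝ → ℝ, Measurable (Function.uncurry M) ∧
      ∀ x ∈ Ioo (0:ℝ) 1, ∀ y ∈ Ioo (0:ℝ) 1, M x y = posKernel φ x y := by
  have hφ : Measurable ((Ioo (0:ℝ) 1).indicator φ) :=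
    (h.antitoneOn.mono Ioo_subset_Icc_self).measurable_indicator_Ioo
  have hD : Measurable ((Ioo (0:ℝ) 1).indicator (Dplus φ)) := by
    have := (h.monotoneOn_Dplus.neg.measurable_indicator_Ioo).neg
    convert this using 1
    ext t
    by_cases ht : t ∈ Ioo (0:ℝ) 1 <;> simp [indicator, ht]
  set φ' := (Ioo (0:ℝ) 1).indicator φ
  set d := (Ioo (0:ℝ) 1).indicator (Dplus φ)
  have hC : Measurable fun p : ℝ × ℝ => pseudoInv φ (φ' p.1 + φ' p.2) :=
    (antitone_pseudoInv φ).measurable.comp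
      ((hφ.comp measurable_fst).add (hφ.comp measurable_snd))
  refine ⟨fun x y => if 0 < pseudoInv φ (φ' x + φ' y) then
    d x / d (pseudoInv φ (φ' x + φ' y)) else 0, ?_, fun x hx y hy => ?_⟩
  · exact Measurable.ite (measurableSet_lt measurable_const hC)
      ((hD.comp measurable_fst).div (hD.comp hC)) measurable_const
  · have hx' : φ' x = φ x := indicator_of_mem hx φ
    have hy' : φ' y = φ y := indicator_of_mem hy φ
    have hdx : d x = Dplus φ x := indicator_of_mem hx _
    simp only [hx', hy', hdx, posKernel]
    change (if 0 < archCopula φ x y then Dplus φ x / d (archCopula φ x y) else 0) = _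
    split_ifs with hc
    · rw [show d (archCopula φ x y) = _ from indicator_of_mem (h.archCopula_mem_Ioo hx hc) _]
    · rfl

lemma aestronglyMeasurable_abs_sub (h : IsGenerator φ) (h' : IsGenerator ψ) :
    AEStronglyMeasurable (Function.uncurry fun y x => |posKernel φ x y - posKernel ψ x y|)
      (unitVolume.prod unitVolume) := by
  obtain ⟨M, hM, hMe⟩ := h.exists_measurable_eq_posKernel
  obtain ⟨N, hN, hNe⟩ := h'.exists_measurable_eq_posKernel
  have hmeas : Measurable fun p : ℝ × ℝ => |M p.2 p.1 - N p.2 p.1| :=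
    ((hM.comp measurable_swap).sub (hN.comp measurable_swap)).abs
  refine hmeas.aestronglyMeasurable.congr ?_
  rw [Measure.prod_restrict]
  filter_upwards [ae_restrict_mem (measurableSet_Ioo.prod measurableSet_Ioo)] with p hp
  simp only [Function.uncurry, hMe _ hp.2 _ hp.1, hNe _ hp.2 _ hp.1]

lemma integrable_abs_sub (h : IsGenerator φ) (h' : IsGenerator ψ) :
    Integrable (Function.uncurry fun y x => |posKernel φ x y - posKernel ψ x y|)
      (unitVolume.prod unitVolume) := by
  refine Integrable.of_bound (h.aestronglyMeasurable_abs_sub h') 1 ?_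
  rw [Measure.prod_restrict]
  filter_upwards [ae_restrict_mem (measurableSet_Ioo.prod measurableSet_Ioo)] with p hp
  simpa [Function.uncurry] using h.abs_posKernel_sub_le_one h' hp.2 p.1

lemma aestronglyMeasurable_posKernel_left (h : IsGenerator φ) (hy : y ∈ Ioo (0:ℝ) 1) :
    AEStronglyMeasurable (fun x => posKernel φ x y) unitVolume := by
  obtain ⟨M, hM, hMe⟩ := h.exists_measurable_eq_posKernel
  refine (hM.comp (measurable_id.prodMk measurable_const)).aestronglyMeasurable.congr
    (f := fun x => M x y) ?_
  filter_upwards [ae_restrict_mem measurableSet_Ioo] with x hx using hMe x hx y hy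

lemma aestronglyMeasurable_posKernel_right (h : IsGenerator φ) (hx : x ∈ Ioo (0:ℝ) 1) :
    AEStronglyMeasurable (fun y => posKernel φ x y) unitVolume := by
  obtain ⟨M, hM, hMe⟩ := h.exists_measurable_eq_posKernel
  refine (hM.comp (measurable_const.prodMk measurable_id)).aestronglyMeasurable.congr
    (f := fun y => M x y) ?_
  filter_upwards [ae_restrict_mem measurableSet_Ioo] with y hy using hMe x hx y hy

lemma integrable_posKernel (h : IsGenerator φ) (hy : y ∈ Ioo (0:ℝ) 1) :
    Integrable (fun x => posKernel φ x y) unitVolume := by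
  refine Integrable.of_bound (h.aestronglyMeasurable_posKernel_left hy) 1 ?_
  filter_upwards [ae_restrict_mem measurableSet_Ioo] with x hx
  rw [Real.norm_of_nonneg (h.posKernel_nonneg hx y)]
  exact h.posKernel_le_one hx y

lemma intervalIntegrable_posKernel (h : IsGenerator φ) (hx : 0 ≤ x) (hxa : x ≤ a) (ha : a ≤ 1)
    (hy : y ∈ Ioo (0:ℝ) 1) : IntervalIntegrable (fun t => posKernel φ t y) volume x a := by
  rw [intervalIntegrable_iff_integrableOn_Ioo_of_le hxa]
  exact IntegrableOn.mono_set (h.integrable_posKernel hy) (Ioo_subset_Ioo hx ha)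

/-! ### The copula as an integral of the kernel -/

lemma hasDerivWithinAt_archCopula (h : IsGenerator φ) (hx : x ∈ Ioo (0:ℝ) 1)
    (hy : y ∈ Ioo (0:ℝ) 1) (hpos : 0 < archCopula φ x y) :
    HasDerivWithinAt (fun t => archCopula φ t y) (posKernel φ x y) (Ioi x) x := by
  have hxc := Ioo_subset_Ioc_self hx
  have hcm := h.archCopula_mem_Ioo hx hpos
  have hfx := (hasDerivWithinAt_iff_tendsto_slope' (by simp)).1 (h.hasDerivWithinAt_toReal hx)
  have hfc := (hasDerivWithinAt_iff_tendsto_slope' (by simp)).1 (h.hasDerivWithinAt_toReal hcm)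
  have hev : ∀ᶠ t in nhdsWithin x (Ioi x), t ∈ Ioo x 1 := Ioo_mem_nhdsGT hx.2
  have heq : ∀ t ∈ Ioo x 1, archCopula φ x y < archCopula φ t y ∧
      (φ (archCopula φ t y)).toReal - (φ (archCopula φ x y)).toReal
        = (φ t).toReal - (φ x).toReal := by
    intro t ht
    have htm : t ∈ Ioc (0:ℝ) 1 := ⟨hx.1.trans ht.1, ht.2.le⟩
    have hle := h.archCopula_mono_left (Ioo_subset_Icc_self hx) (Ioc_subset_Icc_self htm)
      ht.1.le y
    have h1 := h.toReal_archCopula hxc hy hpos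
    have h2 := h.toReal_archCopula htm hy (hpos.trans_le hle)
    have h3 := h.strictAntiOn_toReal hxc htm ht.1
    refine ⟨hle.lt_of_ne fun he => ?_, by linarith⟩
    rw [← he] at h2
    simp only at h3
    linarith
  have hg : Tendsto (fun t => archCopula φ t y) (nhdsWithin x (Ioi x))
      (nhdsWithin (archCopula φ x y) (Ioi (archCopula φ x y))) := by
    refine tendsto_nhdsWithin_iff.2 ⟨?_, hev.mono fun t ht => (heq t ht).1⟩
    exact ((h.continuousOn_archCopula hy).continuousAt (Icc_mem_nhds hx.1 hx.2)).mono_left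
      nhdsWithin_le_nhds
  rw [hasDerivWithinAt_iff_tendsto_slope' (by simp), posKernel, if_pos hpos]
  refine (hfx.div (hfc.comp hg) (h.Dplus_neg hcm).ne).congr' ?_
  filter_upwards [hev] with t ht
  obtain ⟨h1, h2⟩ := heq t ht
  have htm : t ∈ Ioc (0:ℝ) 1 := ⟨hx.1.trans ht.1, ht.2.le⟩
  have h3 := h.strictAntiOn_toReal hxc htm ht.1
  simp only [Pi.div_apply, Function.comp_apply, slope_def_field, h2] at h3 ⊢
  have h4 : (φ t).toReal - (φ x).toReal ≠ 0 := by linarith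
  have h5 : t - x ≠ 0 := by linarith [ht.1]
  have h6 : archCopula φ t y - archCopula φ x y ≠ 0 := by linarith
  field_simp

lemma integral_posKernel_of_pos (h : IsGenerator φ) (hx : x ∈ Icc (0:ℝ) 1) (hy : y ∈ Ioo (0:ℝ) 1)
    (hpos : ∀ t ∈ Ioo x 1, 0 < archCopula φ t y) :
    ∫ t in x..1, posKernel φ t y = y - archCopula φ x y := by
  rw [intervalIntegral.integral_eq_sub_of_hasDeriv_right_of_le hx.2
    ((h.continuousOn_archCopula hy).mono (Icc_subset_Icc_left hx.1))
    (fun t ht => h.hasDerivWithinAt_archCopula ⟨hx.1.trans_lt ht.1, ht.2⟩ hy (hpos t ht))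
    (h.intervalIntegrable_posKernel hx.1 hx.2 le_rfl hy),
    h.archCopula_one_left (Ioo_subset_Icc_self hy)]

lemma integral_posKernel (h : IsGenerator φ) (hx : x ∈ Icc (0:ℝ) 1) (hy : y ∈ Ioo (0:ℝ) 1) :
    ∫ t in x..1, posKernel φ t y = y - archCopula φ x y := by
  rcases (archCopula_nonneg φ x y).eq_or_lt with h0 | hpos
  swap
  · refine h.integral_posKernel_of_pos hx hy fun t ht => hpos.trans_le ?_
    exact h.archCopula_mono_left hx ⟨hx.1.trans ht.1.le, ht.2.le⟩ ht.1.le y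
  have hcl : IsClosed (Icc x 1 ∩ (fun t => archCopula φ t y) ⁻¹' {0}) :=
    ((h.continuousOn_archCopula hy).mono (Icc_subset_Icc_left hx.1)).preimage_isClosed_of_isClosed
      isClosed_Icc isClosed_singleton
  obtain ⟨z, ⟨hz, hz0⟩, hzmax⟩ :=
    (isCompact_Icc.of_isClosed_subset hcl inter_subset_left).exists_isGreatest
      ⟨x, ⟨le_rfl, hx.2⟩, h0.symm⟩
  simp only [mem_preimage, mem_singleton_iff] at hz0
  have hzm : z ∈ Icc (0:ℝ) 1 := ⟨hx.1.trans hz.1, hz.2⟩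
  rw [← intervalIntegral.integral_add_adjacent_intervals
    (h.intervalIntegrable_posKernel hx.1 hz.1 hz.2 hy)
    (h.intervalIntegrable_posKernel hzm.1 hz.2 le_rfl hy),
    h.integral_posKernel_of_pos hzm hy, hz0, ← h0]
  · rw [intervalIntegral.integral_zero_ae, zero_add]
    refine ae_of_all _ fun t ht => ?_
    rw [uIoc_of_le hz.1] at ht
    rw [posKernel, if_neg]
    rw [not_lt, ← hz0]
    exact h.archCopula_mono_left ⟨hx.1.trans ht.1.le, ht.2.trans hz.2⟩ hzm ht.2 y
  · intro t ht
    refine (archCopula_nonneg φ t y).lt_of_ne fun h0t => ?_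
    exact absurd (hzmax ⟨⟨hz.1.trans ht.1.le, ht.2.le⟩, h0t.symm⟩) (not_le.2 ht.1)

lemma abs_archCopula_sub_le_integral (h : IsGenerator φ) (h' : IsGenerator ψ)
    (hx : x ∈ Icc (0:ℝ) 1) (hy : y ∈ Ioo (0:ℝ) 1) :
    |archCopula φ x y - archCopula ψ x y| ≤
      ∫ t, |posKernel φ t y - posKernel ψ t y| ∂unitVolume := by
  have hi := ((h.integrable_posKernel hy).sub (h'.integrable_posKernel hy)).abs
  have hd : archCopula φ x y - archCopula ψ x y =
      -∫ t in x..1, (posKernel φ t y - posKernel ψ t y) := by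
    rw [intervalIntegral.integral_sub (h.intervalIntegrable_posKernel hx.1 hx.2 le_rfl hy)
      (h'.intervalIntegrable_posKernel hx.1 hx.2 le_rfl hy), h.integral_posKernel hx hy,
      h'.integral_posKernel hx hy]
    ring
  rw [hd, abs_neg]
  refine (intervalIntegral.abs_integral_le_integral_abs hx.2).trans ?_
  rw [intervalIntegral.integral_of_le hx.2, integral_Ioc_eq_integral_Ioo]
  exact setIntegral_mono_set hi (ae_of_all _ fun t => abs_nonneg _)
    (Ioo_subset_Ioo_left hx.1).eventuallyLE

end IsGenerator

namespace IsGenerator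

variable {φ : ℝ → ℝ≥0∞} {φseq : ℕ → ℝ → ℝ≥0∞} {x y : ℝ}

/-! ### From convergence of the generators to convergence of the kernels -/

lemma tendsto_Dplus (h : IsGenerator φ) (hseq : ∀ n, IsGenerator (φseq n))
    (hT : ∀ x ∈ Ioc (0:ℝ) 1, Tendsto (fun n => (φseq n x).toReal) atTop (nhds (φ x).toReal))
    {z : ℝ} {u : ℕ → ℝ} (hz : z ∈ Ioo (0:ℝ) 1) (hc : ContinuousAt (Dplus φ) z)
    (hu : Tendsto u atTop (nhds z)) :
    Tendsto (fun n => Dplus (φseq n) (u n)) atTop (nhds (Dplus φ z)) := by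
  have hslope : ∀ a ∈ Ioo (0:ℝ) 1, ∀ b ∈ Ioo (0:ℝ) 1,
      Tendsto (fun n => ((φseq n b).toReal - (φseq n a).toReal) / (b - a)) atTop
        (nhds (((φ b).toReal - (φ a).toReal) / (b - a))) := fun a ha b hb =>
    ((hT b (Ioo_subset_Ioc_self hb)).sub (hT a (Ioo_subset_Ioc_self ha))).div_const _
  refine tendsto_order.2 ⟨fun r hr => ?_, fun r hr => ?_⟩
  · obtain ⟨a, har, ha⟩ := (((hc.mono_left nhdsWithin_le_nhds).eventually (lt_mem_nhds hr)).and
      (Ioo_mem_nhdsLT hz.1)).exists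
    obtain ⟨b, hab, hbz⟩ := exists_between ha.2
    have ham : a ∈ Ioo (0:ℝ) 1 := ⟨ha.1, ha.2.trans hz.2⟩
    have hbm : b ∈ Ioo (0:ℝ) 1 := ⟨ha.1.trans hab, hbz.trans hz.2⟩
    filter_upwards [(hslope a ham b hbm).eventually
      (lt_mem_nhds (har.trans_le (h.Dplus_le_slope ha.1 hab hbm.2.le))),
      hu.eventually (Ioo_mem_nhds hbz hz.2)] with n h1 h2
    exact (h1.trans_le ((hseq n).slope_le_Dplus ha.1 hab hbm.2)).trans_le
      ((hseq n).monotoneOn_Dplus hbm ⟨hbm.1.trans h2.1, h2.2⟩ h2.1.le)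
  · obtain ⟨b, hbr, hb⟩ := (((hc.mono_left nhdsWithin_le_nhds).eventually (gt_mem_nhds hr)).and
      (Ioo_mem_nhdsGT hz.2)).exists
    obtain ⟨a, hza, hab⟩ := exists_between hb.1
    have ham : a ∈ Ioo (0:ℝ) 1 := ⟨hz.1.trans hza, hab.trans hb.2⟩
    have hbm : b ∈ Ioo (0:ℝ) 1 := ⟨hz.1.trans hb.1, hb.2⟩
    filter_upwards [(hslope a ham b hbm).eventually
      (gt_mem_nhds ((h.slope_le_Dplus ham.1 hab hbm.2).trans_lt hbr)),
      hu.eventually (Ioo_mem_nhds hz.1 hza)] with n h1 h2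
    exact (((hseq n).monotoneOn_Dplus ⟨h2.1, h2.2.trans ham.2⟩ ham h2.2.le).trans
      ((hseq n).Dplus_le_slope ham.1 hab hbm.2.le)).trans_lt h1

lemma tendsto_archCopula_of_pos (h : IsGenerator φ) (hseq : ∀ n, IsGenerator (φseq n))
    (hT : ∀ x ∈ Ioc (0:ℝ) 1, Tendsto (fun n => (φseq n x).toReal) atTop (nhds (φ x).toReal))
    (hx : x ∈ Ioo (0:ℝ) 1) (hy : y ∈ Ioo (0:ℝ) 1) (hpos : 0 < archCopula φ x y) :
    Tendsto (fun n => archCopula (φseq n) x y) atTop (nhds (archCopula φ x y)) := by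
  have hxc := Ioo_subset_Ioc_self hx
  have hyc := Ioo_subset_Ioc_self hy
  have hcm := h.archCopula_mem_Ioo hx hpos
  have hsum := (hT x hxc).add (hT y hyc)
  refine tendsto_order.2 ⟨fun r hr => ?_, fun r hr => ?_⟩
  · obtain ⟨a, ha, hac⟩ := exists_between (max_lt hr hpos)
    obtain ⟨hra, ha0⟩ := max_lt_iff.1 ha
    have ham : a ∈ Ioc (0:ℝ) 1 := ⟨ha0, (hac.trans hcm.2).le⟩
    have hlt := h.strictAntiOn_toReal ham (Ioo_subset_Ioc_self hcm) hac
    simp only [h.toReal_archCopula hxc hy hpos] at hlt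
    filter_upwards [hsum.eventually_lt (hT a ham) hlt] with n hn
    exact hra.trans_le ((hseq n).le_archCopula hxc hyc ham hn.le)
  · obtain ⟨a, hca, ha⟩ := exists_between (lt_min hr hcm.2)
    obtain ⟨har, ha1⟩ := lt_min_iff.1 ha
    have ham : a ∈ Ioc (0:ℝ) 1 := ⟨hpos.trans hca, ha1.le⟩
    filter_upwards [(hT a ham).eventually_lt hsum
      (h.toReal_lt_of_archCopula_lt hxc hyc ha1.le hca)] with n hn
    exact ((hseq n).archCopula_le hxc hyc ham hn).trans_lt har

lemma tendsto_posKernel (h : IsGenerator φ) (hseq : ∀ n, IsGenerator (φseq n))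
    (hT : ∀ x ∈ Ioc (0:ℝ) 1, Tendsto (fun n => (φseq n x).toReal) atTop (nhds (φ x).toReal))
    (hx : x ∈ Ioo (0:ℝ) 1) (hxc : ContinuousAt (Dplus φ) x) (hy : y ∈ Ioo (0:ℝ) 1)
    (hne : φ x + φ y ≠ φ 0)
    (hc : 0 < archCopula φ x y → ContinuousAt (Dplus φ) (archCopula φ x y)) :
    Tendsto (fun n => posKernel (φseq n) x y) atTop (nhds (posKernel φ x y)) := by
  have hx' := Ioo_subset_Ioc_self hx
  have hy' := Ioo_subset_Ioc_self hy
  have hDx := h.tendsto_Dplus hseq hT hx hxc tendsto_const_nhds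
  by_cases hpos : 0 < archCopula φ x y
  · have hcm := h.archCopula_mem_Ioo hx hpos
    have hC := h.tendsto_archCopula_of_pos hseq hT hx hy hpos
    rw [posKernel, if_pos hpos]
    refine (hDx.div (h.tendsto_Dplus hseq hT hcm (hc hpos) hC) (h.Dplus_neg hcm).ne).congr' ?_
    filter_upwards [hC.eventually (lt_mem_nhds hpos)] with n hn
    simp [posKernel, if_pos hn]
  rw [posKernel, if_neg hpos]
  have hgt : φ 0 < φ x + φ y :=
    lt_of_le_of_ne (not_lt.1 fun hlt => hpos ((h.archCopula_pos_iff hx' hy).2 hlt)) hne.symm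
  have hsumtop : φ x + φ y ≠ ⊤ := ENNReal.add_ne_top.2 ⟨h.ne_top hx', h.ne_top hy'⟩
  have hδ : 0 < (φ x).toReal + (φ y).toReal - (φ 0).toReal := by
    rw [← ENNReal.toReal_add (h.ne_top hx') (h.ne_top hy'), sub_pos]
    exact ENNReal.toReal_strict_mono hsumtop hgt
  set δ := (φ x).toReal + (φ y).toReal - (φ 0).toReal with hδdef
  have hle0 : ∀ a ∈ Ioc (0:ℝ) 1, (φ a).toReal ≤ (φ 0).toReal := fun a ha =>
    ENNReal.toReal_mono hgt.ne_top
      (h.strict_anti 0 ⟨le_rfl, zero_le_one⟩ a (Ioc_subset_Icc_self ha) ha.1).le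
  refine tendsto_order.2 ⟨fun r hr => Eventually.of_forall fun n =>
    hr.trans_le ((hseq n).posKernel_nonneg hx y), fun ε hε => ?_⟩
  have hB : 0 < 1 - Dplus φ x := by linarith [h.Dplus_neg hx]
  set B := 1 - Dplus φ x with hBdef
  set a := min (1/2) (ε * δ / (4 * B))
  have ha0 : 0 < a := lt_min (by norm_num) (by positivity)
  have ham : a ∈ Ioc (0:ℝ) 1 := ⟨ha0, (min_le_left _ _).trans (by norm_num)⟩
  have haB : a * (4 * B) ≤ ε * δ := (le_div_iff₀ (by positivity)).1 (min_le_right _ _)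
  filter_upwards [hDx.eventually (lt_mem_nhds (show -B < Dplus φ x by linarith)),
    ((hT a ham).add_const (δ/2)).eventually_lt ((hT x hx').add (hT y hy'))
      (by linarith [hle0 a ham])] with n h1 h2
  rw [posKernel]
  split_ifs with hn
  swap
  · exact hε
  have hcm := (hseq n).archCopula_mem_Ioo hx hn
  have h3 := (hseq n).toReal_archCopula hx' hy hn
  have hDn := (hseq n).Dplus_neg hcm
  set c := archCopula (φseq n) x y
  have hca : c < a := by
    by_contra! hac
    have := (hseq n).strictAntiOn_toReal.antitoneOn ham (Ioo_subset_Ioc_self hcm) hac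
    linarith
  have h4 := (hseq n).Dplus_le_slope hcm.1 hca ham.2
  rw [le_div_iff₀ (by linarith)] at h4
  have h5 : Dplus (φseq n) c * a ≤ -(δ/2) := by nlinarith [hcm.1]
  rw [div_lt_iff_of_neg hDn]
  by_contra! hcon
  have h6 : -B < ε * Dplus (φseq n) c := h1.trans_le hcon
  nlinarith [mul_lt_mul_of_pos_right h6 ha0, mul_le_mul_of_nonneg_left h5 hε.le, mul_pos hε hδ]

lemma countable_archCopula_discontinuity (h : IsGenerator φ) (hx : x ∈ Ioo (0:ℝ) 1) :
    {y | y ∈ Ioo (0:ℝ) 1 ∧ 0 < archCopula φ x y ∧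
      ¬ ContinuousAt (Dplus φ) (archCopula φ x y)}.Countable := by
  refine MapsTo.countable_of_injOn (f := archCopula φ x) ?_ ?_ h.countable_not_continuousAt_Dplus
  · rintro y ⟨-, hpos, hc⟩
    exact ⟨h.archCopula_mem_Ioo hx hpos, hc⟩
  rintro s ⟨hs, hs0, -⟩ t ⟨ht, ht0, -⟩ hst
  have h1 := h.toReal_archCopula (Ioo_subset_Ioc_self hx) hs hs0
  have h2 := h.toReal_archCopula (Ioo_subset_Ioc_self hx) ht ht0
  rw [hst] at h1
  exact h.strictAntiOn_toReal.injOn (Ioo_subset_Ioc_self hs) (Ioo_subset_Ioc_self ht)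
    (add_left_cancel (h1.symm.trans h2))

lemma tendsto_D1 (h : IsGenerator φ) (hseq : ∀ n, IsGenerator (φseq n))
    (hT : ∀ x ∈ Ioc (0:ℝ) 1, Tendsto (fun n => (φseq n x).toReal) atTop (nhds (φ x).toReal)) :
    Tendsto (fun n => D1 (archKernel (φseq n)) (archKernel φ)) atTop (nhds 0) := by
  have hswap : ∀ n, D1 (archKernel (φseq n)) (archKernel φ) =
      ∫ x, ∫ y, |posKernel (φseq n) x y - posKernel φ x y| ∂unitVolume ∂unitVolume := fun n => by
    rw [(hseq n).D1_eq h, integral_integral_swap ((hseq n).integrable_abs_sub h)]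
  simp only [hswap]
  rw [show (0:ℝ) = ∫ _, (0:ℝ) ∂unitVolume by simp]
  have hmeas : ∀ n, ∀ x ∈ Ioo (0:ℝ) 1, AEStronglyMeasurable
      (fun y => |posKernel (φseq n) x y - posKernel φ x y|) unitVolume := fun n x hx => by
    exact (((hseq n).aestronglyMeasurable_posKernel_right hx).sub
      (h.aestronglyMeasurable_posKernel_right hx)).norm
  have hbound : ∀ n, ∀ x ∈ Ioo (0:ℝ) 1, ∀ y,
      ‖|posKernel (φseq n) x y - posKernel φ x y|‖ ≤ 1 := fun n x hx y => by
    simpa using (hseq n).abs_posKernel_sub_le_one h hx y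
  refine tendsto_integral_of_dominated_convergence (fun _ => 1) (fun n => ?_)
    (integrable_const 1) (fun n => ?_) ?_
  · exact ((hseq n).integrable_abs_sub h).swap.aestronglyMeasurable.integral_prod_right'
  · filter_upwards [ae_restrict_mem measurableSet_Ioo] with x hx
    refine (norm_integral_le_of_norm_le_const (ae_of_all _ (hbound n x hx))).trans ?_
    simp
  · filter_upwards [ae_restrict_mem measurableSet_Ioo,
      h.countable_not_continuousAt_Dplus.ae_notMem unitVolume] with x hx hxc
    rw [show (0:ℝ) = ∫ _, (0:ℝ) ∂unitVolume by simp]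
    refine tendsto_integral_of_dominated_convergence (fun _ => 1) (fun n => hmeas n x hx)
      (integrable_const 1) (fun n => ae_of_all _ (hbound n x hx)) ?_
    filter_upwards [ae_restrict_mem measurableSet_Ioo, h.ae_add_ne hx,
      (h.countable_archCopula_discontinuity hx).ae_notMem unitVolume] with y hy hne hc
    have hlim := h.tendsto_posKernel hseq hT hx (by_contra fun hn => hxc ⟨hx, hn⟩) hy
      (by rwa [add_comm]) (fun hp => by_contra fun hn => hc ⟨hy, hp, hn⟩)
    simpa using (hlim.sub_const (posKernel φ x y)).abs

/-! ### From convergence of the kernels to convergence of the copulas -/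

lemma mul_abs_archCopula_sub_le {ψ : ℝ → ℝ≥0∞} (h : IsGenerator φ) (h' : IsGenerator ψ)
    {δ : ℝ} (hx : x ∈ Ioo (0:ℝ) 1) (hy : y ∈ Ioo (0:ℝ) 1) (hδ : 0 ≤ δ) (hδy : y + δ ≤ 1) :
    (|archCopula φ x y - archCopula ψ x y| - 2 * δ) * δ ≤
      D1 (archKernel φ) (archKernel ψ) := by
  rw [h.D1_eq h']
  have hi := (h.integrable_abs_sub h').integral_prod_left
  simp only [Function.uncurry] at hi
  have hsub : Ioo y (y + δ) ⊆ Ioo 0 1 := Ioo_subset_Ioo hy.1.le hδy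
  have hlow := setIntegral_ge_of_const_le_real (μ := volume)
    (c := |archCopula φ x y - archCopula ψ x y| - 2 * δ)
    (measurableSet_Ioo (a := y) (b := y + δ)) (by simp) (fun s hs => ?_)
    (IntegrableOn.mono_set hi hsub)
  · rw [Real.volume_real_Ioo_of_le (by linarith), add_sub_cancel_left] at hlow
    refine hlow.trans (setIntegral_mono_set hi (ae_of_all _ fun s => ?_) hsub.eventuallyLE)
    exact integral_nonneg fun t => abs_nonneg _
  · have hs' := hsub hs
    have h1 := h.abs_archCopula_sub_le_integral h' (Ioo_subset_Icc_self hx) hs'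
    have h2 := h.abs_archCopula_sub_le (Ioo_subset_Icc_self hy) (Ioo_subset_Icc_self hs') hx
    have h3 := h'.abs_archCopula_sub_le (Ioo_subset_Icc_self hy) (Ioo_subset_Icc_self hs') hx
    rw [archCopula_comm φ y, archCopula_comm φ s] at h2
    rw [archCopula_comm ψ y, archCopula_comm ψ s] at h3
    have h4 : |y - s| ≤ δ := by rw [abs_le]; constructor <;> linarith [hs.1, hs.2]
    refine le_trans ?_ h1
    rw [abs_le] at h2 h3
    have h5 := neg_abs_le (archCopula φ x s - archCopula ψ x s)
    have h6 := le_abs_self (archCopula φ x s - archCopula ψ x s)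
    rw [sub_le_iff_le_add, abs_le]
    constructor <;> linarith [h2.1, h2.2, h3.1, h3.2]

lemma tendsto_archCopula (h : IsGenerator φ) (hseq : ∀ n, IsGenerator (φseq n))
    (hD : Tendsto (fun n => D1 (archKernel (φseq n)) (archKernel φ)) atTop (nhds 0))
    (hx : x ∈ Ioc (0:ℝ) 1) (hy : y ∈ Ioo (0:ℝ) 1) :
    Tendsto (fun n => archCopula (φseq n) x y) atTop (nhds (archCopula φ x y)) := by
  rcases hx.2.eq_or_lt with rfl | hx1
  · simp only [(hseq _).archCopula_one_left (Ioo_subset_Icc_self hy),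
      h.archCopula_one_left (Ioo_subset_Icc_self hy)]
    exact tendsto_const_nhds
  refine Metric.tendsto_nhds.2 fun ε hε => ?_
  have hδ : 0 < min (ε / 4) (1 - y) := lt_min (by linarith) (by linarith [hy.2])
  have hδ1 := min_le_left (ε / 4) (1 - y)
  have hδ2 := min_le_right (ε / 4) (1 - y)
  set δ := min (ε / 4) (1 - y)
  filter_upwards [hD.eventually (gt_mem_nhds (show 0 < ε / 2 * δ by positivity))] with n hn
  have h1 := (hseq n).mul_abs_archCopula_sub_le h ⟨hx.1, hx1⟩ hy hδ.le (by linarith)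
  have h2 := lt_of_mul_lt_mul_right (h1.trans_lt hn) hδ.le
  rw [Real.dist_eq]
  linarith

end IsGenerator

/-! ### From convergence of the copulas to convergence of the generators -/

/-- The diagonal powers `u ↦ C(… C(C(1, u), u) …, u)` of an Archimedean copula. -/
def copulaPow (φ : ℝ → ℝ≥0∞) (u : ℝ) : ℕ → ℝ
  | 0 => 1
  | k + 1 => archCopula φ (copulaPow φ u k) u

namespace IsGenerator

variable {φ : ℝ → ℝ≥0∞} {φseq : ℕ → ℝ → ℝ≥0∞} {x u : ℝ}

lemma copulaPow_mem_Icc (h : IsGenerator φ) (u : ℝ) (k : ℕ) : copulaPow φ u k ∈ Icc (0:ℝ) 1 := by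
  induction k with
  | zero => exact ⟨zero_le_one, le_rfl⟩
  | succ k ih => exact h.archCopula_mem_Icc ih u

lemma copulaPow_pos_of_succ (h : IsGenerator φ) {k : ℕ} (hk : 0 < copulaPow φ u (k + 1)) :
    0 < copulaPow φ u k :=
  hk.trans_le (h.archCopula_le_left (h.copulaPow_mem_Icc u k) u)

lemma toReal_copulaPow (h : IsGenerator φ) (hu : u ∈ Ioo (0:ℝ) 1) {k : ℕ}
    (hk : 0 < copulaPow φ u k) : (φ (copulaPow φ u k)).toReal = k * (φ u).toReal := by
  induction k with
  | zero => simp [copulaPow, h.map_one]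
  | succ k ih =>
    have hk' := h.copulaPow_pos_of_succ hk
    have := h.toReal_archCopula ⟨hk', (h.copulaPow_mem_Icc u k).2⟩ hu hk
    rw [copulaPow, this, ih hk']
    push_cast
    ring

lemma copulaPow_pos (h : IsGenerator φ) (hu : u ∈ Ioo (0:ℝ) 1) (hx : x ∈ Ioc (0:ℝ) 1) {k : ℕ}
    (hk : k * (φ u).toReal ≤ (φ x).toReal) : 0 < copulaPow φ u k := by
  induction k with
  | zero => exact one_pos
  | succ k ih =>
    push_cast at hk
    have hu0 := h.toReal_pos hu
    have hk' := ih (by linarith)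
    refine hx.1.trans_le (h.le_archCopula ⟨hk', (h.copulaPow_mem_Icc u k).2⟩
      (Ioo_subset_Ioc_self hu) hx ?_)
    rw [h.toReal_copulaPow hu hk']
    linarith

lemma tendsto_copulaPow (h : IsGenerator φ) (hseq : ∀ n, IsGenerator (φseq n))
    (hC : ∀ x ∈ Ioc (0:ℝ) 1, ∀ y ∈ Ioo (0:ℝ) 1,
      Tendsto (fun n => archCopula (φseq n) x y) atTop (nhds (archCopula φ x y)))
    (hu : u ∈ Ioo (0:ℝ) 1) {k : ℕ} (hk : 0 < copulaPow φ u k) :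
    Tendsto (fun n => copulaPow (φseq n) u k) atTop (nhds (copulaPow φ u k)) := by
  induction k with
  | zero => exact tendsto_const_nhds
  | succ k ih =>
    have hk' := h.copulaPow_pos_of_succ hk
    have hm := h.copulaPow_mem_Icc u k
    have hdiff : Tendsto (fun n => archCopula (φseq n) (copulaPow (φseq n) u k) u -
        archCopula (φseq n) (copulaPow φ u k) u) atTop (nhds 0) := by
      refine squeeze_zero_norm (fun n => (hseq n).abs_archCopula_sub_le
        ((hseq n).copulaPow_mem_Icc u k) hm hu) ?_
      simpa using ((ih hk').sub_const (copulaPow φ u k)).abs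
    simpa [copulaPow] using hdiff.add (hC _ ⟨hk', hm.2⟩ u hu)

lemma eventually_nat_mul_lt (h : IsGenerator φ) (hseq : ∀ n, IsGenerator (φseq n))
    (hC : ∀ x ∈ Ioc (0:ℝ) 1, ∀ y ∈ Ioo (0:ℝ) 1,
      Tendsto (fun n => archCopula (φseq n) x y) atTop (nhds (archCopula φ x y)))
    (hu : u ∈ Ioo (0:ℝ) 1) (hx : x ∈ Ioc (0:ℝ) 1) {k : ℕ}
    (hk : k * (φ u).toReal < (φ x).toReal) :
    ∀ᶠ n in atTop, k * (φseq n u).toReal < (φseq n x).toReal := by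
  have hpos := h.copulaPow_pos hu hx hk.le
  have hxk : x < copulaPow φ u k := by
    rw [← h.toReal_copulaPow hu hpos] at hk
    exact (h.strictAntiOn_toReal.lt_iff_gt ⟨hpos, (h.copulaPow_mem_Icc u k).2⟩ hx).1 hk
  filter_upwards [(h.tendsto_copulaPow hseq hC hu hpos).eventually (lt_mem_nhds hxk)] with n hn
  have hn0 := hx.1.trans hn
  rw [← (hseq n).toReal_copulaPow hu hn0]
  exact (hseq n).strictAntiOn_toReal hx ⟨hn0, ((hseq n).copulaPow_mem_Icc u k).2⟩ hn

lemma eventually_lt_nat_mul (h : IsGenerator φ) (hseq : ∀ n, IsGenerator (φseq n))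
    (hC : ∀ x ∈ Ioc (0:ℝ) 1, ∀ y ∈ Ioo (0:ℝ) 1,
      Tendsto (fun n => archCopula (φseq n) x y) atTop (nhds (archCopula φ x y)))
    (hu : u ∈ Ioo (0:ℝ) 1) (hx : x ∈ Ioc (0:ℝ) 1) {a : ℝ} (ha : a ∈ Ioc (0:ℝ) 1) {k : ℕ}
    (hk : (φ x).toReal < k * (φ u).toReal) (hka : k * (φ u).toReal ≤ (φ a).toReal) :
    ∀ᶠ n in atTop, (φseq n x).toReal < k * (φseq n u).toReal := by
  have hpos := h.copulaPow_pos hu ha hka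
  have hxk : copulaPow φ u k < x := by
    rw [← h.toReal_copulaPow hu hpos] at hk
    exact (h.strictAntiOn_toReal.lt_iff_gt hx ⟨hpos, (h.copulaPow_mem_Icc u k).2⟩).1 hk
  filter_upwards [(h.tendsto_copulaPow hseq hC hu hpos).eventually (Ioo_mem_nhds hpos hxk)]
    with n hn
  rw [← (hseq n).toReal_copulaPow hu hn.1]
  exact (hseq n).strictAntiOn_toReal ⟨hn.1, ((hseq n).copulaPow_mem_Icc u k).2⟩ hx hn.2

end IsGenerator

lemma exists_nat_mul_lt_lt_add_two_mul {v ε : ℝ} (hv : 0 < v) (hε : 0 < ε) :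
    ∃ k : ℕ, k * ε < v ∧ v < (k + 2 : ℕ) * ε := by
  obtain ⟨k, hk⟩ : ∃ k, ⌈v / ε⌉₊ = k + 1 :=
    Nat.exists_eq_add_one_of_ne_zero (Nat.ceil_pos.2 (by positivity)).ne'
  refine ⟨k, ?_, ?_⟩
  · rw [← lt_div_iff₀ hε, ← Nat.lt_ceil, hk]
    exact Nat.lt_succ_self k
  · rw [← div_lt_iff₀ hε]
    have := Nat.le_ceil (v / ε)
    rw [hk] at this
    push_cast at this ⊢
    linarith

namespace IsGenerator

variable {φ : ℝ → ℝ≥0∞} {φseq : ℕ → ℝ → ℝ≥0∞} {x : ℝ}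

lemma exists_bracket (h : IsGenerator φ) (hseq : ∀ n, IsGenerator (φseq n))
    (hC : ∀ x ∈ Ioc (0:ℝ) 1, ∀ y ∈ Ioo (0:ℝ) 1,
      Tendsto (fun n => archCopula (φseq n) x y) atTop (nhds (archCopula φ x y)))
    (hx : x ∈ Ioo (0:ℝ) 1) {δ : ℝ} (hδ : 0 < δ) :
    ∃ ε : ℝ, 0 < ε ∧ ε < δ ∧ ∃ j k : ℕ,
      j * ε < (φ x).toReal ∧ (φ x).toReal < (j + 2 : ℕ) * ε ∧ k * ε < 1 ∧ 1 < (k + 2 : ℕ) * ε ∧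
      ∀ᶠ n in atTop, ∃ e : ℝ, 0 < e ∧ j * e < (φseq n x).toReal ∧
        (φseq n x).toReal < (j + 2 : ℕ) * e ∧ k * e < 1 ∧ 1 < (k + 2 : ℕ) * e := by
  have hxh : x / 2 ∈ Ioc (0:ℝ) 1 := ⟨by linarith [hx.1], by linarith [hx.2]⟩
  have hxc := Ioo_subset_Ioc_self hx
  have hhalf : (1/2 : ℝ) ∈ Ioc (0:ℝ) 1 := by norm_num
  have hquart : (1/4 : ℝ) ∈ Ioc (0:ℝ) 1 := by norm_num
  have h1 := h.strictAntiOn_toReal hxh hxc (by linarith [hx.1])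
  have h2 := h.strictAntiOn_toReal hquart hhalf (by norm_num)
  simp only [h.toReal_half] at h1 h2
  obtain ⟨η, hη0, hη⟩ := exists_between (show 0 < min δ (min (((φ (x/2)).toReal - (φ x).toReal) / 2)
    (min (((φ (1/4)).toReal - 1) / 2) 1)) from
      lt_min hδ (lt_min (by linarith) (lt_min (by linarith) one_pos)))
  simp only [lt_min_iff] at hη
  obtain ⟨hη1, hη2, hη3, hη4⟩ := hη
  have hu : 1 - η / 2 ∈ Ioo (0:ℝ) 1 := ⟨by linarith, by linarith⟩
  have hε0 := h.toReal_pos hu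
  have hεη : (φ (1 - η / 2)).toReal ≤ η := by
    have := h.toReal_le_two_mul (x := 1 - η / 2) (by linarith) (by linarith)
    linarith
  obtain ⟨j, hj1, hj2⟩ := exists_nat_mul_lt_lt_add_two_mul (h.toReal_pos hx) hε0
  obtain ⟨k, hk1, hk2⟩ := exists_nat_mul_lt_lt_add_two_mul one_pos hε0
  refine ⟨_, hε0, hεη.trans_lt hη1, j, k, hj1, hj2, hk1, hk2, ?_⟩
  filter_upwards [h.eventually_nat_mul_lt hseq hC hu hxc hj1,
    h.eventually_lt_nat_mul hseq hC hu hxc hxh hj2 (by push_cast; linarith),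
    h.eventually_nat_mul_lt hseq hC hu hhalf (by rwa [h.toReal_half]),
    h.eventually_lt_nat_mul hseq hC hu hhalf hquart (by rwa [h.toReal_half])
      (by push_cast; linarith)] with n e1 e2 e3 e4
  rw [(hseq n).toReal_half] at e3 e4
  exact ⟨_, (hseq n).toReal_pos hu, e1, e2, e3, e4⟩

lemma tendsto_toReal (h : IsGenerator φ) (hseq : ∀ n, IsGenerator (φseq n))
    (hC : ∀ x ∈ Ioc (0:ℝ) 1, ∀ y ∈ Ioo (0:ℝ) 1,
      Tendsto (fun n => archCopula (φseq n) x y) atTop (nhds (archCopula φ x y)))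
    (hx : x ∈ Ioo (0:ℝ) 1) :
    Tendsto (fun n => (φseq n x).toReal) atTop (nhds (φ x).toReal) := by
  have hv := h.toReal_pos hx
  refine tendsto_order.2 ⟨fun r hr => ?_, fun r hr => ?_⟩
  · rcases lt_or_ge r 0 with hr0 | hr0
    · exact Eventually.of_forall fun n => hr0.trans ((hseq n).toReal_pos hx)
    obtain ⟨ε, hε0, hεδ, j, k, hj1, hj2, hk1, hk2, hev⟩ := h.exists_bracket hseq hC hx
      (δ := ((φ x).toReal - r) / (2 * r + 2)) (div_pos (by linarith) (by linarith))
    rw [lt_div_iff₀ (by linarith)] at hεδ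
    have hkj : r * (k + 2) < j := by
      push_cast at hj2
      refine lt_of_mul_lt_mul_right ?_ hε0.le
      nlinarith [mul_le_mul_of_nonneg_left hk1.le hr0]
    filter_upwards [hev] with n hn
    obtain ⟨e, he0, e1, e2, e3, e4⟩ := hn
    push_cast at e4
    nlinarith [mul_lt_mul_of_pos_right hkj he0, mul_le_mul_of_nonneg_left e4.le hr0]
  · have hr0 := hv.trans hr
    obtain ⟨ε, hε0, hεδ, j, k, hj1, hj2, hk1, hk2, hev⟩ := h.exists_bracket hseq hC hx
      (δ := (r - (φ x).toReal) / (2 * r + 2)) (div_pos (by linarith) (by linarith))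
    rw [lt_div_iff₀ (by linarith)] at hεδ
    have hkj : (j : ℝ) + 2 < r * k := by
      push_cast at hk2
      refine lt_of_mul_lt_mul_right ?_ hε0.le
      nlinarith [mul_le_mul_of_nonneg_left hk2.le hr0.le]
    filter_upwards [hev] with n hn
    obtain ⟨e, he0, e1, e2, e3, e4⟩ := hn
    push_cast at e2
    nlinarith [mul_lt_mul_of_pos_right hkj he0, mul_le_mul_of_nonneg_left e3.le hr0.le]

end IsGenerator

/-- For Archimedean copulas, pointwise convergence of the generators on
`(0,1]` is equivalent to convergence of the copulas with respect to the metric `D₁`. -/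
theorem stmt12 (φ : ℝ → ℝ≥0∞) (φseq : ℕ → ℝ → ℝ≥0∞)
    (hφ : IsGenerator φ) (hφseq : ∀ n, IsGenerator (φseq n)) :
    (∀ x ∈ Set.Ioc (0:ℝ) 1,
        Filter.Tendsto (fun n => φseq n x) Filter.atTop (nhds (φ x)))
      ↔ Filter.Tendsto (fun n => D1 (archKernel (φseq n)) (archKernel φ))
          Filter.atTop (nhds 0) := by
  have hiff : ∀ x ∈ Set.Ioc (0:ℝ) 1,
      (Tendsto (fun n => φseq n x) atTop (nhds (φ x)) ↔
        Tendsto (fun n => (φseq n x).toReal) atTop (nhds (φ x).toReal)) := fun x hx =>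
    (ENNReal.tendsto_toReal_iff (fun n => (hφseq n).ne_top hx) (hφ.ne_top hx)).symm
  constructor
  · intro hT
    exact hφ.tendsto_D1 hφseq fun x hx => (hiff x hx).1 (hT x hx)
  · intro hD x hx
    rcases hx.2.eq_or_lt with rfl | hx1
    · simp [hφ.map_one, (hφseq _).map_one]
    · exact (hiff x hx).2 (hφ.tendsto_toReal hφseq
        (fun a ha b hb => hφ.tendsto_archCopula hφseq hD ha hb) ⟨hx.1, hx1⟩)
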